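/- Let p > 3 be a prime and n = 2(p-1). The subgroup E_{0,p-1} of Out(F_n) is conjugate to the factor Z/p × 1 of E_2 ≅ Z/p × Z/p (in particular E_{0,p-1} is subconjugate to E_2), while neither E_R nor any of the subgroups E_{s,p-1-s} with 1 ≤ s ≤ (p-1)/2 is conjugate to a subgroup of E_2. -/

import Mathlib

/-!
Formalization of statements from:
H. Glover, H.-W. Henn, "On the mod-p cohomology of Out(F_{2(p-1)})".
-/

noncomputable section
namespace OutFormal
open FreeGroup

/-! ### The outer automorphism group `Out G = Aut G / Inn G` -/

variable (G : Type) [Group G]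

instance conjRangeNormal : ((MulAut.conj : G →* MulAut G).range).Normal := by
  constructor
  rintro x ⟨g, rfl⟩ f
  refine ⟨f g, ?_⟩
  ext h
  simp only [MulAut.conj_apply, MulAut.mul_apply, MulAut.inv_def, _root_.map_mul,
    _root_.map_inv, MulEquiv.apply_symm_apply]

/-- `Out G = Aut G / Inn G`, the group of outer automorphisms of `G`. -/
def Out : Type := MulAut G ⧸ (MulAut.conj : G →* MulAut G).range

instance : Group (Out G) := QuotientGroup.Quotient.group _

/-- The class of an automorphism in `Out G`. -/
def Out.mk : MulAut G →* Out G := QuotientGroup.mk' _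

/-- `Out(F_n)` for `F_n` the free group on `n` generators. -/
abbrev OutF (n : ℕ) : Type := Out (FreeGroup (Fin n))

variable {G}

/-- The subgroups `H` and `K` of `G` are conjugate. -/
def SubConj (H K : Subgroup G) : Prop :=
  ∃ g : G, Subgroup.map (MulAut.conj g : G ≃* G).toMonoidHom H = K

/-- `H` is subconjugate to `K`, i.e. conjugate to a subgroup of `K`. -/
def SubConjLE (H K : Subgroup G) : Prop :=
  ∃ g : G, Subgroup.map (MulAut.conj g : G ≃* G).toMonoidHom H ≤ K

/-- An elementary abelian `p`-subgroup: an abelian subgroup of exponent dividing `p`. -/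
def IsElementaryAbelian (p : ℕ) (H : Subgroup G) : Prop :=
  (∀ a ∈ H, ∀ b ∈ H, a * b = b * a) ∧ ∀ a ∈ H, a ^ p = 1

/-- The set of outer classes of those automorphisms of the free group `F_n` which act on
the free basis, transported along the identification `eI : I ≃ Fin n`, by the
formula `rhs`.  (There is exactly one such automorphism.) -/
def formalGen {n : ℕ} {I : Type} (eI : I ≃ Fin n) (rhs : I → FreeGroup I) :
    Set (OutF n) :=
  {x | ∃ φ : MulAut (FreeGroup (Fin n)),
    (∀ k : I, φ (FreeGroup.of (eI k)) = FreeGroup.freeGroupCongr eI (rhs k)) ∧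
      x = Out.mk _ φ}

/-! ### The elementary abelian subgroups `E_R`, `E_{s,p-1-s}`, `E_2`, `Δ(E_2)` -/

/-- The effect, on the free basis `u_1, …, u_{p-1}` of the fundamental group of the graph
`Θ_{p-1}` (with `u_i = b_i b_0⁻¹` for the `p` edges `b_0, …, b_{p-1}`), of the graph
automorphism cyclically rotating the `p` edges. -/
def rotWord (p : ℕ) (hp : 0 < p - 1) (k : Fin (p - 1)) : FreeGroup (Fin (p - 1)) :=
  if h : (k : ℕ) + 1 < p - 1 then of ⟨(k : ℕ) + 1, h⟩ * (of ⟨0, hp⟩)⁻¹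
  else (of ⟨0, hp⟩)⁻¹

/-- Basis of `F_{2(p-1)}` adapted to the rose `R_{2(p-1)}`:
`p` petals `x_1, …, x_p` and `p-2` further petals `y_1, …, y_{p-2}`. -/
def eRose (p : ℕ) (h2 : 2 ≤ p) : Fin p ⊕ Fin (p - 2) ≃ Fin (2 * (p - 1)) :=
  finSumFinEquiv.trans (finCongr (by omega))

/-- The generator of `E_R`: it cyclically permutes the petals `x_1, …, x_p`
and fixes the petals `y_1, …, y_{p-2}`. -/
def rhsRose (p : ℕ) : Fin p ⊕ Fin (p - 2) → FreeGroup (Fin p ⊕ Fin (p - 2))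
  | Sum.inl i => of (Sum.inl (finRotate p i))
  | Sum.inr j => of (Sum.inr j)

/-- The subgroup `E_R ≤ Out(F_{2(p-1)})` of order `p` coming from the rose
`R_{2(p-1)}` with the identity marking. -/
def ERose (p : ℕ) (h2 : 2 ≤ p) : Subgroup (OutF (2 * (p - 1))) :=
  Subgroup.closure (formalGen (eRose p h2) (rhsRose p))

/-- Basis of `F_{2(p-1)}` adapted to the graph `Θ_{p-1}^{s,p-1-s}`:
`s` loops `a_i` at the base vertex, the `p-1` classes `u_i = b_i b_0⁻¹` of the edges of
`Θ_{p-1}`, and `p-1-s` loops `c_i` at the other vertex (conjugated back to the base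
vertex by the edge `b_0`). -/
def eTheta (p s : ℕ) (hs : s ≤ p - 1) (h2 : 2 ≤ p) :
    Fin s ⊕ (Fin (p - 1) ⊕ Fin (p - 1 - s)) ≃ Fin (2 * (p - 1)) :=
  ((Equiv.refl (Fin s)).sumCongr finSumFinEquiv).trans
    (finSumFinEquiv.trans (finCongr (by omega)))

/-- The generator of `E_{s,p-1-s}`, induced by the graph automorphism of
`Θ_{p-1}^{s,p-1-s}` cyclically rotating the `p` edges of `Θ_{p-1}` and fixing all
attached loops. -/
def rhsTheta (p s : ℕ) (hp : 0 < p - 1) :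
    Fin s ⊕ (Fin (p - 1) ⊕ Fin (p - 1 - s)) →
      FreeGroup (Fin s ⊕ (Fin (p - 1) ⊕ Fin (p - 1 - s)))
  | Sum.inl a => of (Sum.inl a)
  | Sum.inr (Sum.inl k) => FreeGroup.map (fun i => Sum.inr (Sum.inl i)) (rotWord p hp k)
  | Sum.inr (Sum.inr c) =>
      of (Sum.inr (Sum.inl ⟨0, hp⟩)) * of (Sum.inr (Sum.inr c)) *
        (of (Sum.inr (Sum.inl ⟨0, hp⟩)))⁻¹

/-- The subgroup `E_{s,p-1-s} ≤ Out(F_{2(p-1)})` of order `p` coming from the marked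
graph `Θ_{p-1}^{s,p-1-s}`. -/
def ETheta (p s : ℕ) (hs : s ≤ p - 1) (h2 : 2 ≤ p) : Subgroup (OutF (2 * (p - 1))) :=
  Subgroup.closure (formalGen (eTheta p s hs h2) (rhsTheta p s (by omega)))

/-- Basis of `F_{2(p-1)}` adapted to the wedge `Θ_{p-1} ∨ Θ_{p-1}` (based at the wedge
point): the edge classes `u_i` for the left copy and `w_i` for the right copy. -/
def eWedge (p : ℕ) : Fin (p - 1) ⊕ Fin (p - 1) ≃ Fin (2 * (p - 1)) :=
  finSumFinEquiv.trans (finCongr (by omega))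

/-- The automorphism rotating the `p` edges of the left copy of `Θ_{p-1}` in
`Θ_{p-1} ∨ Θ_{p-1}`. -/
def rhsWedgeL (p : ℕ) (hp : 0 < p - 1) :
    Fin (p - 1) ⊕ Fin (p - 1) → FreeGroup (Fin (p - 1) ⊕ Fin (p - 1))
  | Sum.inl k => FreeGroup.map Sum.inl (rotWord p hp k)
  | Sum.inr k => of (Sum.inr k)

/-- The automorphism rotating the `p` edges of the right copy of `Θ_{p-1}` in
`Θ_{p-1} ∨ Θ_{p-1}`. -/
def rhsWedgeR (p : ℕ) (hp : 0 < p - 1) :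
    Fin (p - 1) ⊕ Fin (p - 1) → FreeGroup (Fin (p - 1) ⊕ Fin (p - 1))
  | Sum.inl k => of (Sum.inl k)
  | Sum.inr k => FreeGroup.map Sum.inr (rotWord p hp k)

/-- The diagonal automorphism, rotating the `p` edges of both copies of `Θ_{p-1}`. -/
def rhsWedgeDiag (p : ℕ) (hp : 0 < p - 1) :
    Fin (p - 1) ⊕ Fin (p - 1) → FreeGroup (Fin (p - 1) ⊕ Fin (p - 1))
  | Sum.inl k => FreeGroup.map Sum.inl (rotWord p hp k)
  | Sum.inr k => FreeGroup.map Sum.inr (rotWord p hp k)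

/-- The subgroup `E_2 ≅ Z/p × Z/p` of `Out(F_{2(p-1)})`, generated by the two commuting
edge rotations of the two copies of `Θ_{p-1}` in the marked graph `Θ_{p-1} ∨ Θ_{p-1}`. -/
def E2 (p : ℕ) (h2 : 2 ≤ p) : Subgroup (OutF (2 * (p - 1))) :=
  Subgroup.closure
    (formalGen (eWedge p) (rhsWedgeL p (by omega)) ∪
      formalGen (eWedge p) (rhsWedgeR p (by omega)))

/-- The first factor `Z/p × 1` of `E_2`, generated by the left edge rotation.  Under the
identification of the subgroup `E_{0,p-1}` with a factor of `E_2` this is the subgroup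
denoted `E_{0,p-1}`. -/
def E2Left (p : ℕ) (h2 : 2 ≤ p) : Subgroup (OutF (2 * (p - 1))) :=
  Subgroup.closure (formalGen (eWedge p) (rhsWedgeL p (by omega)))

/-- The diagonal subgroup `Δ(E_2)` of `E_2`. -/
def EDiag (p : ℕ) (h2 : 2 ≤ p) : Subgroup (OutF (2 * (p - 1))) :=
  Subgroup.closure (formalGen (eWedge p) (rhsWedgeDiag p (by omega)))

/-! ### Auxiliary finite groups -/

/-- The symmetric group `Σ_p`. -/
abbrev SymN (p : ℕ) : Type := Equiv.Perm (Fin p)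

/-- The normalizer `N_{Σ_p}(Z/p)` of a subgroup of order `p` of the symmetric group
`Σ_p` (namely of the subgroup generated by the standard `p`-cycle). -/
def NSigma (p : ℕ) : Subgroup (SymN p) :=
  Subgroup.normalizer (Subgroup.zpowers (finRotate p))

/-- The cyclic group `Z/p`, written multiplicatively. -/
abbrev Zc (p : ℕ) : Type := Multiplicative (ZMod p)

/-- `Aut(F_s)`, the automorphism group of the free group of rank `s`. -/
abbrev AutF (s : ℕ) : Type := MulAut (FreeGroup (Fin s))

/-- The homomorphism `Z/2 →* M` sending the generator to a given element whose square
is `1`. -/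
def z2Hom {M : Type*} [Monoid M] (a : M) (ha : a * a = 1) : Zc 2 →* M where
  toFun x := a ^ (Multiplicative.toAdd x).val
  map_one' := by simp
  map_mul' x y := by
    have hsq : a ^ 2 = 1 := by rw [pow_two, ha]
    have key : ∀ m : ℕ, a ^ (m % 2) = a ^ m := by
      intro m
      conv_rhs => rw [← Nat.div_add_mod m 2]
      rw [pow_add, pow_mul, hsq, one_pow, one_mul]
    show a ^ (Multiplicative.toAdd (x * y)).val = _
    have : Multiplicative.toAdd (x * y) = Multiplicative.toAdd x + Multiplicative.toAdd y := rfl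
    rw [this, ZMod.val_add, key, pow_add]

/-- The swap automorphism of `A × A`. -/
def swapAut (A : Type) [Group A] : MulAut (A × A) :=
  (MulEquiv.prodComm : A × A ≃* A × A)

theorem swapAut_sq (A : Type) [Group A] : swapAut A * swapAut A = 1 := by
  ext x
  · rfl
  · rfl

/-- The wreath product `A ≀ Z/2 = (A × A) ⋊ Z/2`, with `Z/2` interchanging the two
factors. -/
def wr2 (A : Type) [Group A] : Type :=
  (A × A) ⋊[z2Hom (swapAut A) (swapAut_sq A)] Zc 2

instance (A : Type) [Group A] : Group (wr2 A) := by
  unfold wr2; infer_instance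

/-! ### Helper material for the proof -/

/-- The elements `b_k b_0⁻¹` for `k` in `ZMod p` (trivial for `k = 0`). -/
def vv {p : ℕ} [NeZero p] {H : Type} [Group H] (ι : Fin (p - 1) → H) (k : ZMod p) : H :=
  if h : k.val = 0 then 1 else ι ⟨k.val - 1, by have := ZMod.val_lt k; omega⟩

section rot
variable {p : ℕ} [NeZero p] {H K : Type} [Group H] [Group K]

theorem vv_zero (ι : Fin (p - 1) → H) : vv ι (0 : ZMod p) = 1 := by
  simp [vv]

theorem val_succ (k : Fin (p - 1)) : ((k : ℕ) + 1 : ZMod p).val = (k : ℕ) + 1 := by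
  have h : (k : ℕ) + 1 < p := by have := k.2; omega
  have := ZMod.val_natCast_of_lt h
  simpa using this

theorem vv_succ (ι : Fin (p - 1) → H) (k : Fin (p - 1)) :
    vv ι ((k : ℕ) + 1 : ZMod p) = ι k := by
  have h := val_succ k
  simp [vv, h]

theorem vv_cases (k : ZMod p) : k = 0 ∨ ∃ j : Fin (p - 1), k = (j : ℕ) + 1 := by
  by_cases h : k.val = 0
  · left; exact (ZMod.val_eq_zero k).1 h
  · right
    have hl := ZMod.val_lt k
    refine ⟨⟨k.val - 1, by omega⟩, ?_⟩
    have h3 : (((k.val - 1) + 1 : ℕ) : ZMod p) = k := by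
      rw [Nat.sub_add_cancel (by omega)]; simp
    simpa using h3.symm

theorem vv_ind (ι : Fin (p - 1) → H) (Ψ : H →* K) (R : ZMod p → K) (h0 : R 0 = 1)
    (h : ∀ k : Fin (p - 1), Ψ (ι k) = R ((k : ℕ) + 1)) (k : ZMod p) : Ψ (vv ι k) = R k := by
  rcases vv_cases k with rfl | ⟨j, rfl⟩
  · rw [vv_zero, h0, _root_.map_one]
  · rw [vv_succ, h]

theorem rotWord_eq (hp : 0 < p - 1) (Φ : FreeGroup (Fin (p - 1)) →* H)
    (ι : Fin (p - 1) → H) (hι : ∀ k, Φ (of k) = ι k) (k : Fin (p - 1)) :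
    Φ (rotWord p hp k) = vv ι ((k : ℕ) + 1 + 1 : ZMod p) * (vv ι (1 : ZMod p))⁻¹ := by
  have h1 : vv ι (1 : ZMod p) = ι ⟨0, hp⟩ := by
    have := vv_succ ι ⟨0, hp⟩
    simpa using this
  rw [h1]
  unfold rotWord
  split_ifs with h
  · have := vv_succ ι ⟨(k : ℕ) + 1, h⟩
    simp only [Nat.cast_add, Nat.cast_one] at this
    rw [this, _root_.map_mul, _root_.map_inv, hι, hι]
  · have hk : (k : ℕ) + 1 + 1 = p := by have := k.2; omega
    have : ((k : ℕ) + 1 + 1 : ZMod p) = 0 := by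
      have : (((k : ℕ) + 1 + 1 : ℕ) : ZMod p) = 0 := by rw [hk]; simp
      simpa using this
    rw [this, vv_zero, one_mul, _root_.map_inv, hι]

end rot

/-- `θ` rotates the family `u` by `i`. -/
def IsRot {p : ℕ} {H : Type} [Group H] (θ : MulAut H) (u : ZMod p → H) (i : ZMod p) : Prop :=
  ∀ k, θ (u k) = u (k + i) * (u i)⁻¹

section isrot
variable {p : ℕ} {H : Type} [Group H] {u : ZMod p → H}

theorem IsRot.one (h0 : u 0 = 1) : IsRot (1 : MulAut H) u 0 := by
  intro k; simp [h0]

theorem IsRot.mul {θ η : MulAut H} {i j : ZMod p} (h : IsRot θ u i) (h' : IsRot η u j) :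
    IsRot (θ * η) u (i + j) := by
  intro k
  rw [MulAut.mul_apply, h' k, _root_.map_mul, _root_.map_inv, h, h, mul_inv_rev, inv_inv]
  rw [show k + j + i = k + (i + j) by ring, show j + i = i + j by ring]
  group

theorem IsRot.inv (h0 : u 0 = 1) {θ : MulAut H} {i : ZMod p} (h : IsRot θ u i) :
    IsRot θ⁻¹ u (-i) := by
  intro k
  apply θ.injective
  rw [MulAut.apply_inv_self, _root_.map_mul, _root_.map_inv, h, h]
  simp [h0]

theorem IsRot.pow (h0 : u 0 = 1) {θ : MulAut H} {i : ZMod p} (h : IsRot θ u i) (m : ℕ) :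
    IsRot (θ ^ m) u (m * i) := by
  induction m with
  | zero => simpa using IsRot.one h0
  | succ m ih =>
    have := ih.mul h
    rw [pow_succ]
    convert this using 1
    push_cast; ring

theorem prod_range_zmod [NeZero p] {A : Type} [CommGroup A] (g : ZMod p → A) :
    ∏ m ∈ Finset.range p, g (m : ZMod p) = ∏ k : ZMod p, g k := by
  refine Finset.prod_bij (fun m _ => (m : ZMod p)) (by simp) ?_ ?_ (by simp)
  · intro a ha b hb hab
    have := congrArg ZMod.val hab
    rwa [ZMod.val_natCast_of_lt (Finset.mem_range.1 ha),
      ZMod.val_natCast_of_lt (Finset.mem_range.1 hb)] at this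
  · intro b _
    exact ⟨b.val, Finset.mem_range.2 (ZMod.val_lt b), by simp⟩

theorem IsRot.norm [Fact p.Prime] (h0 : u 0 = 1) {θ : MulAut H} {i : ZMod p} (h : IsRot θ u i)
    (hi : i ≠ 0) {A : Type} [CommGroup A] (f : H →* A) (k : ZMod p) :
    ∏ m ∈ Finset.range p, f ((θ ^ m) (u k)) = 1 := by
  have e1 : ∀ m : ℕ, f ((θ ^ m) (u k)) =
      (fun z : ZMod p => f (u (k + z * i)) * (f (u (z * i)))⁻¹) (m : ZMod p) := by
    intro m
    rw [h.pow h0 m k, _root_.map_mul, _root_.map_inv]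
  simp_rw [e1]
  rw [prod_range_zmod (fun z : ZMod p => f (u (k + z * i)) * (f (u (z * i)))⁻¹),
    Finset.prod_mul_distrib, Finset.prod_inv_distrib]
  have e2 : ∏ z : ZMod p, f (u (z * i)) = ∏ z : ZMod p, f (u z) :=
    Equiv.prod_comp (Equiv.mulRight₀ i hi) (fun z => f (u z))
  have e3 : ∏ z : ZMod p, f (u (k + z * i)) = ∏ z : ZMod p, f (u z) := by
    rw [← Equiv.prod_comp (Equiv.addLeft k) (fun z => f (u z))]
    exact Equiv.prod_comp (Equiv.mulRight₀ i hi) (fun z => f (u (k + z)))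
  rw [e2, e3, mul_inv_cancel]

theorem IsRot.norm_zero (h0 : u 0 = 1) {θ : MulAut H} (h : IsRot θ u 0)
    {A : Type} [CommGroup A] (f : H →* A) (k : ZMod p) :
    ∏ m ∈ Finset.range p, f ((θ ^ m) (u k)) = f (u k) ^ p := by
  have e1 : ∀ m : ℕ, f ((θ ^ m) (u k)) = f (u k) := by
    intro m
    rw [h.pow h0 m k]; simp [h0]
  simp [e1]

end isrot

theorem abel_pow_eq_one {n p : ℕ} (hp : p ≠ 0) (a : Abelianization (FreeGroup (Fin n)))
    (h : a ^ p = 1) : a = 1 := by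
  obtain ⟨b, hb⟩ : ∃ b : FreeAbelianGroup (Fin n), b = Additive.ofMul a := ⟨_, rfl⟩
  have h' : p • b = 0 := by rw [hb]; exact h
  have h2 := congrArg (FreeAbelianGroup.equivFinsupp (Fin n)) h'
  rw [map_nsmul, map_zero] at h2
  have h3 : FreeAbelianGroup.equivFinsupp (Fin n) b = 0 := by
    ext j
    have := DFunLike.congr_fun h2 j
    simpa [hp] using this
  have h4 := (FreeAbelianGroup.equivFinsupp (Fin n)).map_eq_zero_iff.1 h3
  rw [hb] at h4
  exact h4

/-! ### Outer classes -/

theorem mk_conj {H : Type} [Group H] (x : H) : Out.mk H (MulAut.conj x) = 1 :=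
  (QuotientGroup.eq_one_iff _).2 ⟨x, rfl⟩

theorem mk_eq {H : Type} [Group H] {a b : MulAut H} (h : Out.mk H a = Out.mk H b) :
    ∃ x, b = MulAut.conj x * a := by
  have h1 : Out.mk H (b * a⁻¹) = 1 := by rw [_root_.map_mul, _root_.map_inv, h, mul_inv_cancel]
  obtain ⟨x, hx⟩ := (QuotientGroup.eq_one_iff _).1 h1
  exact ⟨x, by rw [hx]; group⟩

theorem mk_surj {H : Type} [Group H] (x : Out H) : ∃ a, Out.mk H a = x :=
  QuotientGroup.mk'_surjective _ x

theorem hom_ext_basis {n : ℕ} {I K : Type} [Group K] (e : I ≃ Fin n)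
    {f g : FreeGroup (Fin n) →* K} (h : ∀ k, f (of (e k)) = g (of (e k))) : f = g := by
  ext a
  have := h (e.symm a)
  simpa using this

theorem formalGen_eq {n : ℕ} {I : Type} (e : I ≃ Fin n) (rhs : I → FreeGroup I)
    (φ : MulAut (FreeGroup (Fin n)))
    (h : ∀ k : I, φ (FreeGroup.of (e k)) = FreeGroup.freeGroupCongr e (rhs k)) :
    formalGen e rhs = {Out.mk _ φ} := by
  ext x
  constructor
  · rintro ⟨ψ, hψ, rfl⟩
    have : ψ.toMonoidHom = φ.toMonoidHom := by
      apply hom_ext_basis e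
      intro k
      exact (hψ k).trans (h k).symm
    have : ψ = φ := by
      ext1 y
      exact DFunLike.congr_fun this y
    rw [this]; rfl
  · rintro rfl
    exact ⟨φ, h, rfl⟩

/-- The hom defined by values on the transported basis. -/
def homB {n : ℕ} {I K : Type} [Group K] (e : I ≃ Fin n) (g : I → K) :
    FreeGroup (Fin n) →* K := FreeGroup.lift (fun j => g (e.symm j))

theorem homB_of {n : ℕ} {I K : Type} [Group K] (e : I ≃ Fin n) (g : I → K) (k : I) :
    homB e g (of (e k)) = g k := by simp [homB]

theorem exists_aut {n : ℕ} {I : Type} (e : I ≃ Fin n) (g g' : I → FreeGroup (Fin n))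
    (h : ∀ k, homB e g (g' k) = of (e k)) (h' : ∀ k, homB e g' (g k) = of (e k)) :
    ∃ φ : MulAut (FreeGroup (Fin n)), ∀ y, φ y = homB e g y := by
  refine ⟨MonoidHom.toMulEquiv (homB e g) (homB e g') ?_ ?_, fun y => rfl⟩
  · apply hom_ext_basis e; intro k; simp [homB_of, h']
  · apply hom_ext_basis e; intro k; simp [homB_of, h]

/-! ### The Heisenberg group -/

/-- The Heisenberg group over a commutative ring. -/
@[ext] structure Hei (p : ℕ) where
  /-- first coordinate -/
  a : ZMod p
  /-- second coordinate -/
  b : ZMod p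
  /-- central coordinate -/
  c : ZMod p

instance heiGroup (p : ℕ) : Group (Hei p) where
  mul x y := ⟨x.a + y.a, x.b + y.b, x.c + y.c + x.a * y.b⟩
  one := ⟨0, 0, 0⟩
  inv x := ⟨-x.a, -x.b, -x.c + x.a * x.b⟩
  mul_assoc x y z := by
    apply Hei.ext
    · exact add_assoc _ _ _
    · exact add_assoc _ _ _
    · show x.c + y.c + x.a * y.b + z.c + (x.a + y.a) * z.b =
        x.c + (y.c + z.c + y.a * z.b) + x.a * (y.b + z.b)
      ring
  one_mul x := by
    apply Hei.ext
    · exact zero_add _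
    · exact zero_add _
    · show 0 + x.c + 0 * x.b = x.c
      ring
  mul_one x := by
    apply Hei.ext
    · exact add_zero _
    · exact add_zero _
    · show x.c + 0 + x.a * 0 = x.c
      ring
  inv_mul_cancel x := by
    apply Hei.ext
    · exact neg_add_cancel _
    · exact neg_add_cancel _
    · show -x.c + x.a * x.b + x.c + (-x.a) * x.b = 0
      ring

section hei
variable {p : ℕ}
theorem hei_mul_a (x y : Hei p) : (x * y).a = x.a + y.a := rfl
theorem hei_mul_b (x y : Hei p) : (x * y).b = x.b + y.b := rfl
theorem hei_mul_c (x y : Hei p) : (x * y).c = x.c + y.c + x.a * y.b := rfl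
theorem hei_inv_a (x : Hei p) : (x⁻¹).a = -x.a := rfl
theorem hei_inv_b (x : Hei p) : (x⁻¹).b = -x.b := rfl
theorem hei_inv_c (x : Hei p) : (x⁻¹).c = -x.c + x.a * x.b := rfl
theorem hei_one_a : (1 : Hei p).a = 0 := rfl
theorem hei_one_b : (1 : Hei p).b = 0 := rfl
theorem hei_one_c : (1 : Hei p).c = 0 := rfl

/-- first coordinate as a hom -/
def heiA : Hei p →* Multiplicative (ZMod p) where
  toFun x := Multiplicative.ofAdd x.a
  map_one' := rfl
  map_mul' _ _ := rfl

/-- second coordinate as a hom -/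
def heiB : Hei p →* Multiplicative (ZMod p) where
  toFun x := Multiplicative.ofAdd x.b
  map_one' := rfl
  map_mul' _ _ := rfl

theorem abel_hom {H A : Type} [Group H] [CommGroup A] (f : H →* A) {y y' : H}
    (h : Abelianization.of y = Abelianization.of y') : f y = f y' := by
  have := congrArg (Abelianization.lift f) h
  simpa using this

/-- The obstruction identity in the Heisenberg group. -/
theorem hei_obstruction {H : Type} [Group H] (γ : MulAut H) (x : H) (f : H →* Hei p)
    (hA : (heiA.comp f).comp γ.toMonoidHom = heiA.comp f)
    (hB : (heiB.comp f).comp γ.toMonoidHom = heiB.comp f) {y y' : H}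
    (hyy : Abelianization.of y' = Abelianization.of y)
    (hfix : (MulAut.conj x * γ) y' = y') :
    (f (γ y)).c - (f y).c + (f x).a * (f y).b - (f x).b * (f y).a = 0 := by
  have hA' : ∀ z, (f (γ z)).a = (f z).a := fun z => by
    have := DFunLike.congr_fun hA z
    exact this
  have hB' : ∀ z, (f (γ z)).b = (f z).b := fun z => by
    have := DFunLike.congr_fun hB z
    exact this
  let D : H →* Multiplicative (ZMod p) :=
    { toFun := fun z => Multiplicative.ofAdd ((f (γ z)).c - (f z).c)
      map_one' := by simp
      map_mul' := by
        intro z w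
        rw [← ofAdd_add]
        congr 1
        rw [_root_.map_mul, _root_.map_mul, _root_.map_mul, hei_mul_c, hei_mul_c, hA', hB']
        ring }
  have hD : (f (γ y')).c - (f y').c = (f (γ y)).c - (f y).c := abel_hom D hyy
  have ha : (f y').a = (f y).a := abel_hom (heiA.comp f) hyy
  have hb : (f y').b = (f y).b := abel_hom (heiB.comp f) hyy
  have h1 := congrArg (fun z => (f z).c) hfix
  simp only [MulAut.mul_apply, MulAut.conj_apply, _root_.map_mul, _root_.map_inv, hei_mul_c, hei_mul_a,
    hei_inv_c, hei_inv_b, hA', hB', ha, hb] at h1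
  rw [← hD]
  linear_combination h1

end hei

/-! ### Elements of `E_2` -/

/-- The norm of `θ`, composed with a hom to an abelian group. -/
def normHom {H A : Type} [Group H] [CommGroup A] (p : ℕ) (θ : MulAut H) (f : H →* A) : H →* A :=
  ∏ m ∈ Finset.range p, f.comp (θ ^ m).toMonoidHom

theorem normHom_apply {H A : Type} [Group H] [CommGroup A] (p : ℕ) (θ : MulAut H) (f : H →* A)
    (y : H) : normHom p θ f y = ∏ m ∈ Finset.range p, f ((θ ^ m) y) := by
  simp [normHom]

theorem abel_map {H : Type} [Group H] (θ : MulAut H) {y y' : H}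
    (h : Abelianization.of y = Abelianization.of y') :
    Abelianization.of (θ y) = Abelianization.of (θ y') :=
  abel_hom (Abelianization.of.comp θ.toMonoidHom) h

theorem abel_pow {H : Type} [Group H] (θ : MulAut H) {y : H}
    (h : Abelianization.of (θ y) = Abelianization.of y) (m : ℕ) :
    Abelianization.of ((θ ^ m) y) = Abelianization.of y := by
  induction m with
  | zero => simp
  | succ m ih =>
    rw [pow_succ, MulAut.mul_apply, abel_map (θ ^ m) h, ih]

theorem side_fix {n p : ℕ} [Fact p.Prime] {u : ZMod p → FreeGroup (Fin n)} (h0 : u 0 = 1)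
    {θ : MulAut (FreeGroup (Fin n))} {i : ZMod p} (h : IsRot θ u i)
    (π : FreeGroup (Fin n) →* FreeGroup (Fin n))
    (hπ : ∀ y, π y ∈ Subgroup.closure (Set.range u))
    (hc : ∀ y, θ (π y) = π (θ y)) (y : FreeGroup (Fin n))
    (hy : Abelianization.of (θ y) = Abelianization.of y) :
    ∃ v, Abelianization.of v = Abelianization.of (π y) ∧ θ v = v := by
  by_cases hi : i = 0
  · subst hi
    refine ⟨π y, rfl, ?_⟩
    have : Set.EqOn θ.toMonoidHom (MonoidHom.id _) (Subgroup.closure (Set.range u)) := by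
      apply MonoidHom.eqOn_closure
      rintro _ ⟨k, rfl⟩
      show θ (u k) = u k
      rw [h k]; simp [h0]
    exact this (hπ y)
  · refine ⟨1, ?_, by simp⟩
    have h1 : Abelianization.of (θ (π y)) = Abelianization.of (π y) := by
      rw [hc]
      exact abel_hom (Abelianization.of.comp π) hy
    have h2 : Set.EqOn (normHom p θ Abelianization.of) (1 : FreeGroup (Fin n) →* _)
        (Subgroup.closure (Set.range u)) := by
      apply MonoidHom.eqOn_closure
      rintro _ ⟨k, rfl⟩
      rw [normHom_apply, h.norm h0 hi]; rfl
    have h3 := h2 (hπ y)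
    rw [normHom_apply] at h3
    simp only [abel_pow θ h1] at h3
    rw [Finset.prod_const, Finset.card_range] at h3
    rw [abel_pow_eq_one (Nat.Prime.ne_zero Fact.out) _ h3, _root_.map_one]

/-- Left family. -/
def uL (p : ℕ) [NeZero p] : ZMod p → FreeGroup (Fin (2 * (p - 1))) :=
  vv (fun k => of (eWedge p (Sum.inl k)))

/-- Right family. -/
def uR (p : ℕ) [NeZero p] : ZMod p → FreeGroup (Fin (2 * (p - 1))) :=
  vv (fun k => of (eWedge p (Sum.inr k)))

/-- Projection to the left. -/
def piL (p : ℕ) : FreeGroup (Fin (2 * (p - 1))) →* FreeGroup (Fin (2 * (p - 1))) :=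
  homB (eWedge p) (Sum.elim (fun k => of (eWedge p (Sum.inl k))) (fun _ => 1))

/-- Projection to the right. -/
def piR (p : ℕ) : FreeGroup (Fin (2 * (p - 1))) →* FreeGroup (Fin (2 * (p - 1))) :=
  homB (eWedge p) (Sum.elim (fun _ => 1) (fun k => of (eWedge p (Sum.inr k))))

theorem congr_apply_of {n : ℕ} {I : Type} (e : I ≃ Fin n) (k : I) :
    FreeGroup.freeGroupCongr e (of k) = of (e k) := by simp [FreeGroup.freeGroupCongr]

section wedge
variable {p : ℕ} [Fact p.Prime]

theorem uL_zero : uL p 0 = 1 := vv_zero _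
theorem uR_zero : uR p 0 = 1 := vv_zero _
theorem uL_succ (k : Fin (p - 1)) :
    uL p ((k : ℕ) + 1) = of (eWedge p (Sum.inl k)) := vv_succ _ k
theorem uR_succ (k : Fin (p - 1)) :
    uR p ((k : ℕ) + 1) = of (eWedge p (Sum.inr k)) := vv_succ _ k

theorem piL_uL (k : ZMod p) : piL p (uL p k) = uL p k :=
  vv_ind _ _ _ uL_zero (fun k => by rw [uL_succ, piL, homB_of]; rfl) k
theorem piL_uR (k : ZMod p) : piL p (uR p k) = 1 :=
  vv_ind _ _ (fun _ => 1) rfl (fun k => by rw [piL, homB_of]; rfl) k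
theorem piR_uR (k : ZMod p) : piR p (uR p k) = uR p k :=
  vv_ind _ _ _ uR_zero (fun k => by rw [uR_succ, piR, homB_of]; rfl) k
theorem piR_uL (k : ZMod p) : piR p (uL p k) = 1 :=
  vv_ind _ _ (fun _ => 1) rfl (fun k => by rw [piR, homB_of]; rfl) k

theorem wedge_ext {K : Type} [Group K] {f g : FreeGroup (Fin (2 * (p - 1))) →* K}
    (hL : ∀ k, f (uL p k) = g (uL p k)) (hR : ∀ k, f (uR p k) = g (uR p k)) : f = g := by
  apply hom_ext_basis (eWedge p)
  rintro (k | k)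
  · rw [← uL_succ, hL]
  · rw [← uR_succ, hR]

theorem piL_mem (y) : piL p y ∈ Subgroup.closure (Set.range (uL p)) := by
  have : (piL p).range ≤ Subgroup.closure (Set.range (uL p)) := by
    rw [piL, homB, FreeGroup.range_lift_eq_closure, Subgroup.closure_le]
    rintro _ ⟨j, rfl⟩
    rcases h : (eWedge p).symm j with k | k
    · simp only [h, Sum.elim_inl]
      exact Subgroup.subset_closure ⟨_, uL_succ k⟩
    · simp only [h, Sum.elim_inr]
      exact Subgroup.one_mem _
  exact this ⟨y, rfl⟩

theorem piR_mem (y) : piR p y ∈ Subgroup.closure (Set.range (uR p)) := by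
  have : (piR p).range ≤ Subgroup.closure (Set.range (uR p)) := by
    rw [piR, homB, FreeGroup.range_lift_eq_closure, Subgroup.closure_le]
    rintro _ ⟨j, rfl⟩
    rcases h : (eWedge p).symm j with k | k
    · simp only [h, Sum.elim_inl]
      exact Subgroup.one_mem _
    · simp only [h, Sum.elim_inr]
      exact Subgroup.subset_closure ⟨_, uR_succ k⟩
  exact this ⟨y, rfl⟩

theorem E2_fix {θ : MulAut (FreeGroup (Fin (2 * (p - 1))))} {i j : ZMod p}
    (hL : IsRot θ (uL p) i) (hR : IsRot θ (uR p) j) (y : FreeGroup (Fin (2 * (p - 1))))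
    (hy : Abelianization.of (θ y) = Abelianization.of y) :
    ∃ y', Abelianization.of y' = Abelianization.of y ∧ θ y' = y' := by
  have cL : θ.toMonoidHom.comp (piL p) = (piL p).comp θ.toMonoidHom := by
    apply wedge_ext
    · intro k
      show θ (piL p (uL p k)) = piL p (θ (uL p k))
      rw [piL_uL, hL, _root_.map_mul, _root_.map_inv, piL_uL, piL_uL]
    · intro k
      show θ (piL p (uR p k)) = piL p (θ (uR p k))
      rw [piL_uR, hR, _root_.map_mul, _root_.map_inv, piL_uR, piL_uR]; simp
  have cR : θ.toMonoidHom.comp (piR p) = (piR p).comp θ.toMonoidHom := by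
    apply wedge_ext
    · intro k
      show θ (piR p (uL p k)) = piR p (θ (uL p k))
      rw [piR_uL, hL, _root_.map_mul, _root_.map_inv, piR_uL, piR_uL]; simp
    · intro k
      show θ (piR p (uR p k)) = piR p (θ (uR p k))
      rw [piR_uR, hR, _root_.map_mul, _root_.map_inv, piR_uR, piR_uR]
  obtain ⟨v, hv, fv⟩ := side_fix uL_zero hL (piL p) piL_mem (DFunLike.congr_fun cL) y hy
  obtain ⟨w, hw, fw⟩ := side_fix uR_zero hR (piR p) piR_mem (DFunLike.congr_fun cR) y hy
  refine ⟨v * w, ?_, by rw [_root_.map_mul, fv, fw]⟩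
  rw [_root_.map_mul, hv, hw]
  have : (Abelianization.of.comp (piL p)) * (Abelianization.of.comp (piR p))
      = Abelianization.of := by
    apply wedge_ext
    · intro k; simp [piL_uL, piR_uL]
    · intro k; simp [piL_uR, piR_uR]
  exact DFunLike.congr_fun this y

theorem mulZ_pow (a : Multiplicative (ZMod p)) : a ^ p = 1 := by
  have : p • (Multiplicative.toAdd a) = 0 := by simp
  exact this

theorem E2_norm {θ : MulAut (FreeGroup (Fin (2 * (p - 1))))} {i j : ZMod p}
    (hL : IsRot θ (uL p) i) (hR : IsRot θ (uR p) j)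
    (f : FreeGroup (Fin (2 * (p - 1))) →* Multiplicative (ZMod p)) :
    normHom p θ f = 1 := by
  apply wedge_ext
  · intro k
    rw [normHom_apply]
    by_cases hi : i = 0
    · subst hi
      rw [hL.norm_zero uL_zero, mulZ_pow]; rfl
    · rw [hL.norm uL_zero hi]; rfl
  · intro k
    rw [normHom_apply]
    by_cases hi : j = 0
    · subst hi
      rw [hR.norm_zero uR_zero, mulZ_pow]; rfl
    · rw [hR.norm uR_zero hi]; rfl

theorem rot_of {n : ℕ} {I : Type} (e : I ≃ Fin n) (c : Fin (p - 1) → I) (hp : 0 < p - 1)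
    (k : Fin (p - 1)) :
    FreeGroup.freeGroupCongr e (FreeGroup.map c (rotWord p hp k)) =
      vv (fun k => of (e (c k))) ((k : ℕ) + 1 + 1 : ZMod p) *
        (vv (fun k => of (e (c k))) (1 : ZMod p))⁻¹ := by
  have := rotWord_eq hp ((FreeGroup.freeGroupCongr e).toMonoidHom.comp (FreeGroup.map c))
    (fun k => of (e (c k))) (by
      intro k
      show FreeGroup.freeGroupCongr e (FreeGroup.map c (of k)) = _
      rw [FreeGroup.map.of, congr_apply_of]) k
  exact this

theorem E2_mem (h2 : 2 ≤ p) {x : OutF (2 * (p - 1))} (hx : x ∈ E2 p h2) :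
    ∃ θ i j, IsRot θ (uL p) i ∧ IsRot θ (uR p) j ∧ x = Out.mk _ θ := by
  unfold E2 at hx
  induction hx using Subgroup.closure_induction with
  | mem x hx =>
    rcases hx with ⟨φ, hφ, rfl⟩ | ⟨φ, hφ, rfl⟩
    · refine ⟨φ, 1, 0, ?_, ?_, rfl⟩
      · exact vv_ind _ φ.toMonoidHom (fun k => uL p (k + 1) * (uL p 1)⁻¹) (by simp)
          (fun k => (hφ (Sum.inl k)).trans (rot_of _ _ _ _))
      · intro k
        rw [uR_zero, add_zero, inv_one, mul_one]
        exact vv_ind _ φ.toMonoidHom (uR p) uR_zero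
          (fun k => (hφ (Sum.inr k)).trans ((congr_apply_of _ _).trans (uR_succ k).symm)) k
    · refine ⟨φ, 0, 1, ?_, ?_, rfl⟩
      · intro k
        rw [uL_zero, add_zero, inv_one, mul_one]
        exact vv_ind _ φ.toMonoidHom (uL p) uL_zero
          (fun k => (hφ (Sum.inl k)).trans ((congr_apply_of _ _).trans (uL_succ k).symm)) k
      · exact vv_ind _ φ.toMonoidHom (fun k => uR p (k + 1) * (uR p 1)⁻¹) (by simp)
          (fun k => (hφ (Sum.inr k)).trans (rot_of _ _ _ _))
  | one => exact ⟨1, 0, 0, IsRot.one uL_zero, IsRot.one uR_zero, (_root_.map_one _).symm⟩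
  | mul x y _ _ hx hy =>
    obtain ⟨θ, i, j, h1, h2, rfl⟩ := hx
    obtain ⟨θ', i', j', h1', h2', rfl⟩ := hy
    exact ⟨θ * θ', _, _, h1.mul h1', h2.mul h2', (_root_.map_mul _ _ _).symm⟩
  | inv x _ hx =>
    obtain ⟨θ, i, j, h1, h2, rfl⟩ := hx
    exact ⟨θ⁻¹, _, _, h1.inv uL_zero, h2.inv uR_zero, (_root_.map_inv _ _).symm⟩

/-- What subconjugacy of a cyclic subgroup to `E_2` means. -/
theorem subconj_E2 (h2 : 2 ≤ p) (γ : MulAut (FreeGroup (Fin (2 * (p - 1)))))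
    (h : SubConjLE (Subgroup.closure {Out.mk _ γ}) (E2 p h2)) :
    ∃ (g θ : MulAut (FreeGroup (Fin (2 * (p - 1))))) (i j : ZMod p),
      IsRot θ (uL p) i ∧ IsRot θ (uR p) j ∧ Out.mk _ γ = Out.mk _ (g⁻¹ * θ * g) := by
  obtain ⟨g, hg⟩ := h
  obtain ⟨g, rfl⟩ := mk_surj g
  have hm : (MulAut.conj (Out.mk _ g)) (Out.mk _ γ) ∈ E2 p h2 :=
    hg ⟨_, Subgroup.subset_closure rfl, rfl⟩
  obtain ⟨θ, i, j, hL, hR, h⟩ := E2_mem h2 hm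
  refine ⟨g, θ, i, j, hL, hR, ?_⟩
  rw [_root_.map_mul, _root_.map_mul, ← h, _root_.map_inv, MulAut.conj_apply]
  group

theorem subconj_norm (h2 : 2 ≤ p) (γ : MulAut (FreeGroup (Fin (2 * (p - 1)))))
    (h : SubConjLE (Subgroup.closure {Out.mk _ γ}) (E2 p h2))
    (f : FreeGroup (Fin (2 * (p - 1))) →* Multiplicative (ZMod p)) (y) :
    ∏ m ∈ Finset.range p, f ((γ ^ m) y) = 1 := by
  obtain ⟨g, θ, i, j, hL, hR, h⟩ := subconj_E2 h2 γ h
  have key : ∀ m : ℕ, f ((γ ^ m) y) = (f.comp (g⁻¹).toMonoidHom) ((θ ^ m) (g y)) := by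
    intro m
    have h1 : Out.mk _ (γ ^ m) = Out.mk _ (g⁻¹ * θ ^ m * g) := by
      rw [map_pow, h, ← map_pow]
      congr 1
      have := conj_pow (i := m) (a := g⁻¹) (b := θ)
      rw [inv_inv] at this
      exact this
    obtain ⟨x, hx⟩ := mk_eq h1
    show _ = f ((g⁻¹ * θ ^ m * g) y)
    rw [hx, MulAut.mul_apply, MulAut.conj_apply, _root_.map_mul, _root_.map_mul,
      _root_.map_inv, mul_inv_cancel_comm]
  simp_rw [key]
  rw [← normHom_apply, E2_norm hL hR]; rfl

theorem subconj_fix (h2 : 2 ≤ p) (γ : MulAut (FreeGroup (Fin (2 * (p - 1)))))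
    (h : SubConjLE (Subgroup.closure {Out.mk _ γ}) (E2 p h2)) :
    ∃ x : FreeGroup (Fin (2 * (p - 1))), ∀ y, Abelianization.of (γ y) = Abelianization.of y →
      ∃ y', Abelianization.of y' = Abelianization.of y ∧ (MulAut.conj x * γ) y' = y' := by
  obtain ⟨g, θ, i, j, hL, hR, h⟩ := subconj_E2 h2 γ h
  obtain ⟨x, hx⟩ := mk_eq h
  refine ⟨x, fun y hy => ?_⟩
  have h1 : Abelianization.of ((g⁻¹ * θ * g) y) = Abelianization.of y := by
    rw [hx, MulAut.mul_apply, MulAut.conj_apply, _root_.map_mul, _root_.map_mul,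
      _root_.map_inv, mul_inv_cancel_comm, hy]
  have h3 := abel_map g h1
  rw [MulAut.mul_apply, MulAut.mul_apply, MulAut.apply_inv_self] at h3
  obtain ⟨y', e1, e2⟩ := E2_fix hL hR _ h3
  refine ⟨g⁻¹ y', ?_, ?_⟩
  · rw [abel_map g⁻¹ e1, MulAut.inv_apply_self]
  · rw [← hx, MulAut.mul_apply, MulAut.mul_apply, MulAut.apply_inv_self, e2]

end wedge

/-! ### The generators of `E_R` and `E_{s,p-1-s}` -/

theorem rose_aut (p : ℕ) (h2 : 2 ≤ p) :
    ∃ γ : MulAut (FreeGroup (Fin (2 * (p - 1)))), ∀ k,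
      γ (of (eRose p h2 k)) = FreeGroup.freeGroupCongr (eRose p h2) (rhsRose p k) := by
  let σ : Fin p ⊕ Fin (p - 2) ≃ Fin p ⊕ Fin (p - 2) :=
    (finRotate p).sumCongr (Equiv.refl _)
  refine ⟨FreeGroup.freeGroupCongr (((eRose p h2).symm.trans σ).trans (eRose p h2)), ?_⟩
  rintro (k | k)
  · rw [congr_apply_of, rhsRose, congr_apply_of]; simp [σ]
  · rw [congr_apply_of, rhsRose, congr_apply_of]; simp [σ]

theorem finRotate_pow_ne {p : ℕ} (h2 : 2 ≤ p) {m : ℕ} (hm : m < p) (hm0 : m ≠ 0) :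
    ((finRotate p) ^ m) ⟨0, by omega⟩ ≠ ⟨0, by omega⟩ := by
  obtain ⟨q, rfl⟩ : ∃ q, p = q + 1 := ⟨p - 1, by omega⟩
  have key : ∀ m (h : m < q + 1), ((finRotate (q + 1)) ^ m) ⟨0, by omega⟩ = ⟨m, h⟩ := by
    intro m
    induction m with
    | zero => intro h; rfl
    | succ m ih =>
      intro h
      rw [pow_succ', Equiv.Perm.mul_apply, ih (by omega), finRotate_of_lt (by omega)]
  rw [key m hm]
  intro h
  exact hm0 (congrArg Fin.val h)

theorem rose_not {p : ℕ} [Fact p.Prime] (h2 : 2 ≤ p) :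
    ¬ SubConjLE (ERose p h2) (E2 p h2) := by
  intro h
  obtain ⟨γ, hγ⟩ := rose_aut p h2
  rw [ERose, formalGen_eq _ _ γ hγ] at h
  let f : FreeGroup (Fin (2 * (p - 1))) →* Multiplicative (ZMod p) :=
    homB (eRose p h2) (fun k => if k = Sum.inl ⟨0, by omega⟩ then Multiplicative.ofAdd 1 else 1)
  have hpow : ∀ m : ℕ, ∀ k, (γ ^ m) (of (eRose p h2 (Sum.inl k))) =
      of (eRose p h2 (Sum.inl (((finRotate p) ^ m) k))) := by
    intro m
    induction m with
    | zero => intro k; rfl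
    | succ m ih =>
      intro k
      rw [pow_succ, MulAut.mul_apply, hγ, rhsRose, congr_apply_of, ih, pow_succ,
        Equiv.Perm.mul_apply]
  have h1 := subconj_norm h2 γ h f (of (eRose p h2 (Sum.inl ⟨0, by omega⟩)))
  rw [Finset.prod_eq_single 0] at h1
  · rw [hpow, homB_of] at h1
    simp only [pow_zero, Equiv.Perm.one_apply, if_true] at h1
    have h3 : (1 : ZMod p) = 0 := h1
    have : Fact (1 < p) := ⟨by omega⟩
    exact one_ne_zero h3
  · intro m hm hm0
    rw [hpow, homB_of, if_neg]
    intro h5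
    exact finRotate_pow_ne h2 (Finset.mem_range.1 hm) hm0 (Sum.inl.inj h5)
  · intro h5
    exact absurd (Finset.mem_range.2 (by omega)) h5

section theta
variable {p : ℕ} [Fact p.Prime]

/-- The rotated family for `E_{s,p-1-s}`. -/
def uT (p s : ℕ) [NeZero p] (hs : s ≤ p - 1) (h2 : 2 ≤ p) :
    ZMod p → FreeGroup (Fin (2 * (p - 1))) :=
  vv (fun k => of (eTheta p s hs h2 (Sum.inr (Sum.inl k))))

theorem uT_zero (s : ℕ) (hs : s ≤ p - 1) (h2 : 2 ≤ p) : uT p s hs h2 0 = 1 := vv_zero _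

theorem uT_succ (s : ℕ) (hs : s ≤ p - 1) (h2 : 2 ≤ p) (k : Fin (p - 1)) :
    uT p s hs h2 ((k : ℕ) + 1) = of (eTheta p s hs h2 (Sum.inr (Sum.inl k))) := vv_succ _ k

theorem uT_one (s : ℕ) (hs : s ≤ p - 1) (h2 : 2 ≤ p) :
    uT p s hs h2 1 = of (eTheta p s hs h2 (Sum.inr (Sum.inl ⟨0, by omega⟩))) := by
  have := uT_succ s hs h2 ⟨0, by omega⟩
  simpa using this

theorem theta_aut (s : ℕ) (hs : s ≤ p - 1) (h2 : 2 ≤ p) :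
    ∃ γ : MulAut (FreeGroup (Fin (2 * (p - 1)))),
      (∀ k, γ (of (eTheta p s hs h2 k)) =
        FreeGroup.freeGroupCongr (eTheta p s hs h2) (rhsTheta p s (by omega) k)) ∧
      (∀ a, γ (of (eTheta p s hs h2 (Sum.inl a))) = of (eTheta p s hs h2 (Sum.inl a))) ∧
      IsRot γ (uT p s hs h2) 1 ∧
      (∀ c, γ (of (eTheta p s hs h2 (Sum.inr (Sum.inr c)))) =
        uT p s hs h2 1 * of (eTheta p s hs h2 (Sum.inr (Sum.inr c))) * (uT p s hs h2 1)⁻¹) := by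
  set e := eTheta p s hs h2 with he
  set v := uT p s hs h2 with hv
  have v0 : v 0 = 1 := uT_zero s hs h2
  have vs : ∀ k : Fin (p - 1), v ((k : ℕ) + 1) = of (e (Sum.inr (Sum.inl k))) := uT_succ s hs h2
  let G : ZMod p → Fin s ⊕ (Fin (p - 1) ⊕ Fin (p - 1 - s)) → FreeGroup (Fin (2 * (p - 1))) :=
    fun t => Sum.elim (fun a => of (e (Sum.inl a))) (Sum.elim
      (fun k => v ((k : ℕ) + 1 + t) * (v t)⁻¹)
      (fun c => v t * of (e (Sum.inr (Sum.inr c))) * (v t)⁻¹))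
  have hG : ∀ t k, homB e (G t) (v k) = v (k + t) * (v t)⁻¹ := by
    intro t
    exact vv_ind _ (homB e (G t)) (fun k => v (k + t) * (v t)⁻¹) (by simp)
      (fun k => homB_of _ _ _)
  have hGG : ∀ t k, homB e (G t) (G (-t) k) = of (e k) := by
    intro t
    rintro (a | k | c)
    · exact homB_of _ _ _
    · show homB e (G t) (v ((k : ℕ) + 1 + -t) * (v (-t))⁻¹) = _
      rw [_root_.map_mul, _root_.map_inv, hG, hG, neg_add_cancel_right, neg_add_cancel, v0, vs]
      group
    · show homB e (G t) (v (-t) * of (e (Sum.inr (Sum.inr c))) * (v (-t))⁻¹) = _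
      rw [_root_.map_mul, _root_.map_mul, _root_.map_inv, hG, homB_of, neg_add_cancel, v0]
      show 1 * (v t)⁻¹ * (v t * of (e (Sum.inr (Sum.inr c))) * (v t)⁻¹) * (1 * (v t)⁻¹)⁻¹ = _
      group
  obtain ⟨γ, hγ⟩ := exists_aut e (G 1) (G (-1)) (hGG 1) (by
    have := hGG (-1); rwa [neg_neg] at this)
  have ha : ∀ a, γ (of (e (Sum.inl a))) = of (e (Sum.inl a)) := fun a => by
    rw [hγ, homB_of]; rfl
  have hc : ∀ c, γ (of (e (Sum.inr (Sum.inr c)))) =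
      v 1 * of (e (Sum.inr (Sum.inr c))) * (v 1)⁻¹ := fun c => by
    rw [hγ, homB_of]; rfl
  have hr : IsRot γ v 1 := fun k => by rw [hγ, hG]
  refine ⟨γ, ?_, ha, hr, hc⟩
  rintro (a | k | c)
  · rw [ha, rhsTheta, congr_apply_of]
  · rw [← vs, hr, rhsTheta, rot_of]; rfl
  · rw [hc, rhsTheta, _root_.map_mul, _root_.map_mul, _root_.map_inv, congr_apply_of,
      congr_apply_of, hv, uT_one]

theorem theta_not (s : ℕ) (hs : s ≤ p - 1) (h2 : 2 ≤ p) (h1 : 1 ≤ s) (h3 : 1 ≤ p - 1 - s) :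
    ¬ SubConjLE (ETheta p s hs h2) (E2 p h2) := by
  intro h
  obtain ⟨γ, hγ, ha, hr, hc⟩ := theta_aut s hs h2
  rw [ETheta, formalGen_eq _ _ γ hγ] at h
  obtain ⟨x, hx⟩ := subconj_fix h2 γ h
  let f : FreeGroup (Fin (2 * (p - 1))) →* Hei p :=
    homB (eTheta p s hs h2) (Sum.elim (fun _ => ⟨0, 1, 0⟩) (Sum.elim
      (fun k => ⟨(k : ℕ) + 1, 0, 0⟩) (fun _ => ⟨0, 1, 0⟩)))
  have fa : ∀ a, f (of (eTheta p s hs h2 (Sum.inl a))) = ⟨0, 1, 0⟩ := fun a => homB_of _ _ _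
  have fc : ∀ c, f (of (eTheta p s hs h2 (Sum.inr (Sum.inr c)))) = ⟨0, 1, 0⟩ :=
    fun a => homB_of _ _ _
  have fv : ∀ k, f (uT p s hs h2 k) = ⟨k, 0, 0⟩ :=
    vv_ind _ f (fun k => ⟨k, 0, 0⟩) rfl (fun k => homB_of _ _ _)
  have hA' : ∀ z, (heiA.comp f) (γ (of (eTheta p s hs h2 z)))
      = (heiA.comp f) (of (eTheta p s hs h2 z)) := by
    rintro (a | k | c)
    · rw [ha]
    · rw [← uT_succ, hr]
      show (f _).a = (f _).a
      simp [fv, hei_mul_a, hei_inv_a]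
    · rw [hc]; simp
  have hB' : ∀ z, (heiB.comp f) (γ (of (eTheta p s hs h2 z)))
      = (heiB.comp f) (of (eTheta p s hs h2 z)) := by
    rintro (a | k | c)
    · rw [ha]
    · rw [← uT_succ, hr]
      show (f _).b = (f _).b
      simp [fv, hei_mul_b, hei_inv_b]
    · rw [hc]; simp
  have hA : (heiA.comp f).comp γ.toMonoidHom = heiA.comp f := hom_ext_basis _ hA'
  have hB : (heiB.comp f).comp γ.toMonoidHom = heiB.comp f := hom_ext_basis _ hB'
  obtain ⟨y1, e1, f1⟩ := hx (of (eTheta p s hs h2 (Sum.inl ⟨0, h1⟩))) (by rw [ha])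
  obtain ⟨y2, e2, f2⟩ := hx (of (eTheta p s hs h2 (Sum.inr (Sum.inr ⟨0, h3⟩)))) (by
    rw [hc, _root_.map_mul, _root_.map_mul, _root_.map_inv, mul_inv_cancel_comm])
  have o1 := hei_obstruction γ x f hA hB e1 f1
  have o2 := hei_obstruction γ x f hA hB e2 f2
  rw [ha, fa] at o1
  rw [hc, _root_.map_mul, _root_.map_mul, _root_.map_inv, fc, fv] at o2
  simp [hei_mul_c, hei_mul_a, hei_inv_c, hei_inv_b] at o1 o2
  rw [o1] at o2
  simp at o2

theorem theta_zero (h00 : 0 ≤ p - 1) (h2 : 2 ≤ p) :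
    SubConj (ETheta p 0 h00 h2) (E2Left p h2) := by
  obtain ⟨γ, hγ, -, hr, hc⟩ := theta_aut (p := p) 0 h00 h2
  have eI : ∀ k, eTheta p 0 h00 h2 (Sum.inr (Sum.inl k)) = eWedge p (Sum.inl k) := by
    intro k
    apply Fin.ext
    simp [eTheta, eWedge]
  have eC : ∀ k : Fin (p - 1), eTheta p 0 h00 h2 (Sum.inr (Sum.inr k)) =
      eWedge p (Sum.inr k) := by
    intro k
    apply Fin.ext
    simp [eTheta, eWedge]
  have eu : uT p 0 h00 h2 = uL p := by
    unfold uT uL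
    simp_rw [eI]
  rw [eu] at hr hc
  let inv : Fin (p - 1) ⊕ Fin (p - 1) → FreeGroup (Fin (2 * (p - 1))) :=
    Sum.elim (fun k => (of (eWedge p (Sum.inl k)))⁻¹) (fun k => of (eWedge p (Sum.inr k)))
  have hinv : ∀ k, homB (eWedge p) inv (inv k) = of (eWedge p k) := by
    rintro (k | k)
    · show homB (eWedge p) inv (of (eWedge p (Sum.inl k)))⁻¹ = _
      rw [_root_.map_inv, homB_of]
      exact inv_inv _
    · show homB (eWedge p) inv (of (eWedge p (Sum.inr k))) = _
      rw [homB_of]; rfl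
  obtain ⟨ψ, hψ⟩ := exists_aut (eWedge p) inv inv hinv hinv
  have ψL : ∀ k, ψ (uL p k) = (uL p k)⁻¹ :=
    vv_ind _ ψ.toMonoidHom (fun k => (uL p k)⁻¹) (by simp [uL_zero]) (fun k => by
      rw [uL_succ]; show ψ _ = _; rw [hψ, homB_of]; rfl)
  have ψR : ∀ k, ψ (of (eWedge p (Sum.inr k))) = of (eWedge p (Sum.inr k)) := fun k => by
    rw [hψ, homB_of]; rfl
  have ψL' : ∀ k, ψ⁻¹ (uL p k) = (uL p k)⁻¹ := fun k => by
    apply ψ.injective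
    rw [MulAut.apply_inv_self, _root_.map_inv, ψL, inv_inv]
  have ψR' : ∀ k, ψ⁻¹ (of (eWedge p (Sum.inr k))) = of (eWedge p (Sum.inr k)) := fun k => by
    apply ψ.injective
    rw [MulAut.apply_inv_self, ψR]
  let φ : MulAut (FreeGroup (Fin (2 * (p - 1)))) :=
    MulAut.conj (uL p 1) * (ψ * γ * ψ⁻¹)
  have hφ : ∀ k, φ (of (eWedge p k)) =
      FreeGroup.freeGroupCongr (eWedge p) (rhsWedgeL p (by omega) k) := by
    rintro (k | k)
    · rw [rhsWedgeL, rot_of, ← uL_succ]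
      show φ _ = uL p _ * (uL p 1)⁻¹
      simp only [φ, MulAut.mul_apply, MulAut.conj_apply]
      rw [ψL', _root_.map_inv, hr, _root_.map_inv, _root_.map_mul, _root_.map_inv, ψL, ψL]
      group
    · rw [rhsWedgeL, congr_apply_of]
      simp only [φ, MulAut.mul_apply, MulAut.conj_apply]
      rw [ψR', ← eC, hc, eC, _root_.map_mul, _root_.map_mul, _root_.map_inv, ψL, ψR]
      group
  refine ⟨Out.mk _ ψ, ?_⟩
  rw [ETheta, E2Left, formalGen_eq _ _ γ hγ, formalGen_eq _ _ φ hφ, MonoidHom.map_closure,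
    Set.image_singleton]
  congr 2
  show MulAut.conj (Out.mk _ ψ) (Out.mk _ γ) = _
  rw [MulAut.conj_apply, ← _root_.map_inv, ← _root_.map_mul, ← _root_.map_mul]
  simp only [φ]
  rw [_root_.map_mul (Out.mk _) (MulAut.conj (uL p 1)), mk_conj, one_mul]

end theta

/-!
STATEMENT 3.  Let `p > 3` be a prime and `n = 2(p-1)`.  The subgroup `E_{0,p-1}` of
`Out(F_n)` is conjugate to the factor `Z/p × 1` of `E_2 ≅ Z/p × Z/p` (in particular
`E_{0,p-1}` is subconjugate to `E_2`), while neither `E_R` nor any of the subgroups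
`E_{s,p-1-s}` with `1 ≤ s ≤ (p-1)/2` is conjugate to a subgroup of `E_2`.
-/
theorem statement3 (p : ℕ) (hp : p.Prime) (hp3 : 3 < p) :
    -- `E_{0,p-1}` is conjugate to the factor `Z/p × 1` of `E_2`
    SubConj (ETheta p 0 (by omega) (by omega)) (E2Left p (by omega)) ∧
    -- in particular it is subconjugate to `E_2`
    SubConjLE (ETheta p 0 (by omega) (by omega)) (E2 p (by omega)) ∧
    -- `E_R` is not subconjugate to `E_2`
    ¬ SubConjLE (ERose p (by omega)) (E2 p (by omega)) ∧
    -- no `E_{s,p-1-s}` with `1 ≤ s ≤ (p-1)/2` is subconjugate to `E_2`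
    (∀ s (h1 : 1 ≤ s) (hs : 2 * s ≤ p - 1),
      ¬ SubConjLE (ETheta p s (by omega) (by omega)) (E2 p (by omega))) := by
  have : Fact p.Prime := ⟨hp⟩
  refine ⟨theta_zero (Nat.zero_le _) (by omega), ?_, rose_not (by omega), ?_⟩
  · obtain ⟨g, hg⟩ := theta_zero (p := p) (Nat.zero_le _) (by omega)
    exact ⟨g, hg.le.trans (Subgroup.closure_mono Set.subset_union_left)⟩
  · intro s h1 hs
    exact theta_not s _ _ h1 (by omega)

end OutFormal
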